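/- Let A be a Hermitian n×n complex matrix and set B = A − (tr A/n)·I. Then spd(A)⁴ ≥ (12/n)·tr(B⁴) and spd(A)⁶ ≥ (432/n³)·(n·tr(B²)·tr(B⁴) − (tr B²)³ − n·(tr B³)²). -/

import Mathlib

open Finset

/-- The trace of a power of a scalar translate of a Hermitian matrix, in terms of eigenvalues. -/
theorem Matrix.IsHermitian.trace_sub_smul_one_pow {n : ℕ} {A : Matrix (Fin n) (Fin n) ℂ}
    (hA : A.IsHermitian) (m : ℝ) (r : ℕ) :
    ((A - (m : ℂ) • (1 : Matrix (Fin n) (Fin n) ℂ)) ^ r).trace =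
      ((∑ i, (hA.eigenvalues i - m) ^ r : ℝ) : ℂ) := by
  have hconj : A - (m : ℂ) • (1 : Matrix (Fin n) (Fin n) ℂ) =
      Unitary.conjStarAlgAut ℂ _ hA.eigenvectorUnitary
        (Matrix.diagonal fun i => ((hA.eigenvalues i - m : ℝ) : ℂ)) := by
    have hdiag : (Matrix.diagonal fun i => ((hA.eigenvalues i - m : ℝ) : ℂ)) =
        Matrix.diagonal (RCLike.ofReal ∘ hA.eigenvalues) -
          (m : ℂ) • (1 : Matrix (Fin n) (Fin n) ℂ) := by
      ext i j
      by_cases h : i = j <;> simp [h]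
    rw [hdiag, map_sub, map_smul, map_one, ← hA.spectral_theorem]
  rw [hconj, ← map_pow, Unitary.conjStarAlgAut_apply, Matrix.trace_mul_cycle,
    Unitary.coe_star_mul_self, one_mul, Matrix.diagonal_pow, Matrix.trace_diagonal]
  simp

/-- The chord bound for `x ^ 4` on `[a, b]`. -/
theorem pow_four_le_chord {a b x : ℝ} (ha : a ≤ x) (hb : x ≤ b) :
    x ^ 4 ≤ (a + b) * (a ^ 2 + b ^ 2) * x - a * b * (a ^ 2 + a * b + b ^ 2) := by
  have h : 0 ≤ x ^ 2 + (a + b) * x + (a ^ 2 + a * b + b ^ 2) := by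
    nlinarith [sq_nonneg (x + a), sq_nonneg (x + b), sq_nonneg (a + b)]
  nlinarith [mul_nonneg (mul_nonneg (sub_nonneg.2 ha) (sub_nonneg.2 hb)) h]

/-- A distribution on `[a, b]` with mean zero has fourth moment at most `(b - a) ^ 4 / 12`. -/
theorem sum_pow_four_le_of_mem_Icc {ι : Type*} [Fintype ι] {x : ι → ℝ} {a b : ℝ}
    (ha : ∀ i, a ≤ x i) (hb : ∀ i, x i ≤ b) (hx : ∑ i, x i = 0) :
    12 * ∑ i, x i ^ 4 ≤ Fintype.card ι * (b - a) ^ 4 := by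
  have h := Finset.sum_le_sum fun i (_ : i ∈ univ) => pow_four_le_chord (ha i) (hb i)
  rw [Finset.sum_sub_distrib, ← Finset.mul_sum, hx, Finset.sum_const, card_univ,
    nsmul_eq_mul] at h
  have hab : 12 * -(a * b * (a ^ 2 + a * b + b ^ 2)) ≤ (b - a) ^ 4 := by
    nlinarith [sq_nonneg ((b - a) ^ 2 + 6 * (a * b))]
  nlinarith [mul_le_mul_of_nonneg_left hab (Nat.cast_nonneg (α := ℝ) (Fintype.card ι))]

/-- If `c` and `h` are the midpoint and half-length of an interval carrying a mean-zero
distribution with moments `p`, `q`, `r` of orders 2, 3, 4, then `hle` compares the second and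
fourth moments about `c`, and bounds the Hankel determinant of the distribution. -/
theorem hankel_det_le {p q r c h : ℝ} (hp : 0 ≤ p)
    (hle : r - 4 * c * q + 6 * c ^ 2 * p + c ^ 4 ≤ h ^ 2 * (p + c ^ 2)) :
    27 * (p * r - p ^ 3 - q ^ 2) ≤ 4 * h ^ 6 := by
  have hc : p ≤ p + c ^ 2 := by nlinarith [sq_nonneg c]
  set u := p + c ^ 2 with hu
  have hdet : p * r - p ^ 3 - q ^ 2 ≤ p * (u * (h ^ 2 - u)) := by
    have h₁ : r - p ^ 2 - 4 * c * q + 4 * c ^ 2 * p ≤ u * (h ^ 2 - u) := by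
      rw [hu] at hle ⊢; nlinarith
    nlinarith [mul_le_mul_of_nonneg_left h₁ hp, sq_nonneg (q - 2 * c * p)]
  have hu₀ : 0 ≤ u := hp.trans hc
  have hcubic : 27 * (u * (u * (h ^ 2 - u))) ≤ 4 * h ^ 6 := by
    have : 0 ≤ (3 * u - 2 * h ^ 2) ^ 2 * (3 * u + h ^ 2) := by positivity
    nlinarith
  rcases le_total 0 (h ^ 2 - u) with hs | hs
  · nlinarith [mul_le_mul_of_nonneg_right hc (mul_nonneg hu₀ hs)]
  · have : p * (u * (h ^ 2 - u)) ≤ 0 :=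
      mul_nonpos_of_nonneg_of_nonpos hp (mul_nonpos_of_nonneg_of_nonpos hu₀ hs)
    have : 0 ≤ h ^ 6 := by positivity
    linarith

/-- The second and fourth moments about the midpoint of an interval containing the values. -/
theorem sum_sub_midpoint_pow_four_le {ι : Type*} [Fintype ι] {x : ι → ℝ} {a b : ℝ}
    (ha : ∀ i, a ≤ x i) (hb : ∀ i, x i ≤ b) :
    ∑ i, (x i - (a + b) / 2) ^ 4 ≤ ((b - a) / 2) ^ 2 * ∑ i, (x i - (a + b) / 2) ^ 2 := by
  rw [Finset.mul_sum]
  refine Finset.sum_le_sum fun i _ => ?_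
  have h : (x i - (a + b) / 2) ^ 2 ≤ ((b - a) / 2) ^ 2 := by
    nlinarith [mul_nonneg (sub_nonneg.2 (ha i)) (sub_nonneg.2 (hb i))]
  nlinarith [mul_le_mul_of_nonneg_right h (sq_nonneg (x i - (a + b) / 2))]

/-- The Hankel determinant of the empirical moments of mean-zero values in `[a, b]`. -/
theorem hankel_det_le_of_mem_Icc {ι : Type*} [Fintype ι] [Nonempty ι] {x : ι → ℝ} {a b : ℝ}
    (ha : ∀ i, a ≤ x i) (hb : ∀ i, x i ≤ b) (hx : ∑ i, x i = 0) :
    432 / (Fintype.card ι : ℝ) ^ 3 *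
      (Fintype.card ι * (∑ i, x i ^ 2) * (∑ i, x i ^ 4) - (∑ i, x i ^ 2) ^ 3 -
        Fintype.card ι * (∑ i, x i ^ 3) ^ 2) ≤ (b - a) ^ 6 := by
  have hN : (0 : ℝ) < Fintype.card ι := Nat.cast_pos.2 Fintype.card_pos
  have hmid := sum_sub_midpoint_pow_four_le ha hb
  set c := (a + b) / 2
  set N := (Fintype.card ι : ℝ) with hNdef
  have h₂ : ∑ i, (x i - c) ^ 2 = ∑ i, x i ^ 2 + N * c ^ 2 := by
    have : ∀ i, (x i - c) ^ 2 = x i ^ 2 - 2 * c * x i + c ^ 2 := fun i => by ring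
    simp only [this, sum_add_distrib, sum_sub_distrib, ← Finset.mul_sum, hx, sum_const,
      card_univ, nsmul_eq_mul, ← hNdef]
    ring
  have h₄ : ∑ i, (x i - c) ^ 4 =
      ∑ i, x i ^ 4 - 4 * c * ∑ i, x i ^ 3 + 6 * c ^ 2 * ∑ i, x i ^ 2 + N * c ^ 4 := by
    have : ∀ i, (x i - c) ^ 4 =
        x i ^ 4 - 4 * c * x i ^ 3 + 6 * c ^ 2 * x i ^ 2 - 4 * c ^ 3 * x i + c ^ 4 :=
      fun i => by ring
    simp only [this, sum_add_distrib, sum_sub_distrib, ← Finset.mul_sum, hx, sum_const,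
      card_univ, nsmul_eq_mul, ← hNdef]
    ring
  rw [h₂, h₄] at hmid
  have hp : 0 ≤ ∑ i, x i ^ 2 := sum_nonneg fun i _ => sq_nonneg (x i)
  generalize ∑ i, x i ^ 2 = P at *
  generalize ∑ i, x i ^ 3 = Q at *
  generalize ∑ i, x i ^ 4 = R at *
  have key : 27 * (P / N * (R / N) - (P / N) ^ 3 - (Q / N) ^ 2) ≤ 4 * ((b - a) / 2) ^ 6 := by
    refine hankel_det_le (c := c) (by positivity) ?_
    calc R / N - 4 * c * (Q / N) + 6 * c ^ 2 * (P / N) + c ^ 4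
        = (R - 4 * c * Q + 6 * c ^ 2 * P + N * c ^ 4) / N := by field_simp
      _ ≤ ((b - a) / 2) ^ 2 * (P + N * c ^ 2) / N := div_le_div_of_nonneg_right hmid hN.le
      _ = ((b - a) / 2) ^ 2 * (P / N + c ^ 2) := by field_simp
  have hscale : 432 / N ^ 3 * (N * P * R - P ^ 3 - N * Q ^ 2) =
      16 * (27 * (P / N * (R / N) - (P / N) ^ 3 - (Q / N) ^ 2)) := by
    field_simp
    ring
  rw [hscale]
  nlinarith


/-- Inequalities (3.17) and (3.18): for a Hermitian `n × n` complex matrix `A`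
and `B = A − (tr A/n)·I`,
`spd(A)⁴ ≥ (12/n)·tr(B⁴)` and
`spd(A)⁶ ≥ (432/n³)(n·tr(B²)·tr(B⁴) − (tr B²)³ − n·(tr B³)²)`. -/
theorem spread_trace_lower_bounds {n : ℕ} (hn : 0 < n)
    (A : Matrix (Fin n) (Fin n) ℂ) (hA : A.IsHermitian)
    (B : Matrix (Fin n) (Fin n) ℂ)
    (hB : B = A - (A.trace / n) • 1)
    (spd : ℝ)
    (hspd : spd = ⨆ i, ⨆ j, |hA.eigenvalues i - hA.eigenvalues j|) :
    12 / (n : ℝ) * ((B ^ 4).trace).re ≤ spd ^ 4 ∧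
      432 / (n : ℝ) ^ 3 *
        ((n : ℝ) * ((B ^ 2).trace).re * ((B ^ 4).trace).re -
          (((B ^ 2).trace).re) ^ 3 - (n : ℝ) * (((B ^ 3).trace).re) ^ 2)
        ≤ spd ^ 6 := by
  have : Nonempty (Fin n) := ⟨⟨0, hn⟩⟩
  have hn₀ : (0 : ℝ) < n := Nat.cast_pos.2 hn
  set m : ℝ := (∑ i, hA.eigenvalues i) / n with hm
  have htr : A.trace / n = (m : ℂ) := by
    rw [hA.trace_eq_sum_eigenvalues, hm]
    push_cast
    rfl
  have hpow : ∀ r, ((B ^ r).trace).re = ∑ i, (hA.eigenvalues i - m) ^ r := fun r => by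
    rw [hB, htr, hA.trace_sub_smul_one_pow, Complex.ofReal_re]
  have hsum : ∑ i, (hA.eigenvalues i - m) = 0 := by
    rw [sum_sub_distrib, sum_const, card_univ, Fintype.card_fin, nsmul_eq_mul, hm]
    field_simp
    ring
  obtain ⟨k, hk⟩ := Finite.exists_max hA.eigenvalues
  obtain ⟨l, hl⟩ := Finite.exists_min hA.eigenvalues
  have hle : (hA.eigenvalues k - m) - (hA.eigenvalues l - m) ≤ spd := by
    rw [hspd, sub_sub_sub_cancel_right]
    exact (le_abs_self _).trans <|
      (le_ciSup (f := fun j => |hA.eigenvalues k - hA.eigenvalues j|)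
        (Set.finite_range _).bddAbove l).trans
      (le_ciSup (f := fun i => ⨆ j, |hA.eigenvalues i - hA.eigenvalues j|)
        (Set.finite_range _).bddAbove k)
  have hnonneg : 0 ≤ (hA.eigenvalues k - m) - (hA.eigenvalues l - m) := by
    linarith [hk l]
  have ha : ∀ i, hA.eigenvalues l - m ≤ hA.eigenvalues i - m := fun i =>
    sub_le_sub_right (hl i) m
  have hb : ∀ i, hA.eigenvalues i - m ≤ hA.eigenvalues k - m := fun i =>
    sub_le_sub_right (hk i) m
  simp only [hpow]
  constructor
  · refine le_trans ?_ (pow_le_pow_left₀ hnonneg hle 4)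
    have h := sum_pow_four_le_of_mem_Icc ha hb hsum
    rw [Fintype.card_fin] at h
    rwa [div_mul_eq_mul_div, div_le_iff₀' hn₀]
  · refine le_trans ?_ (pow_le_pow_left₀ hnonneg hle 6)
    simpa only [Fintype.card_fin] using hankel_det_le_of_mem_Icc ha hb hsum
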